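/- Let V be a real Banach space and let φ be a weight function. Then V is reflexive (i.e. the canonical embedding of V into its bidual V'' is surjective) if and only if the duality mapping J_V^φ is surjective in the sense that for every v* ∈ V' there exists v ∈ V with v* ∈ J_V^φ(v). -/

import Mathlib

/-- A weight function: continuous, strictly increasing on `[0,∞)`, vanishing at `0`,
mapping `[0,∞)` into `[0,∞)`, and tending to `∞` at `∞`. -/
def IsWeightFun (φ : ℝ → ℝ) : Prop :=
  ContinuousOn φ (Set.Ici 0) ∧ StrictMonoOn φ (Set.Ici 0) ∧ φ 0 = 0 ∧
    (∀ t ∈ Set.Ici (0 : ℝ), 0 ≤ φ t) ∧ Filter.Tendsto φ Filter.atTop Filter.atTop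

/-- The duality set of weight `φ` at `v`. -/
def dualitySet (V : Type*) [NormedAddCommGroup V] [NormedSpace ℝ V]
    (φ : ℝ → ℝ) (v : V) : Set (V →L[ℝ] ℝ) :=
  {f | f v = ‖v‖ * ‖f‖ ∧ ‖f‖ = φ ‖v‖}

namespace JamesReflexivity

open Filter Topology Metric

variable {V : Type*} [NormedAddCommGroup V] [NormedSpace ℝ V]

/-- A functional on the dual at distance at least `d` from the canonical image of `V` is larger
than any `η < d` at some unit-ball element of the annihilator of a given finite set. -/
theorem exists_annihilator_lt_apply (Ψ : (V →L[ℝ] ℝ) →L[ℝ] ℝ) {d η : ℝ}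
    (hd : ∀ x : V, d ≤ ‖Ψ - NormedSpace.inclusionInDoubleDual ℝ V x‖) (hη : η < d)
    (s : Finset V) :
    ∃ f : V →L[ℝ] ℝ, ‖f‖ ≤ 1 ∧ (∀ x ∈ s, f x = 0) ∧ η < Ψ f := by
  let L : V →ₗ[ℝ] ((V →L[ℝ] ℝ) →ₗ[ℝ] ℝ) :=
    (ContinuousLinearMap.coeLM ℝ) ∘ₗ (NormedSpace.inclusionInDoubleDual ℝ V).toLinearMap
  let N : Submodule ℝ (V →L[ℝ] ℝ) := ⨅ x : s, (L x).ker
  have hN : ∀ f, f ∈ N ↔ ∀ x ∈ s, f x = 0 := by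
    intro f
    simp [N, L, Submodule.mem_iInf]
  obtain ⟨Ψ', hext, hnorm⟩ := exists_extension_norm_eq N (Ψ.comp N.subtypeL)
  have hspan : ((Ψ - Ψ' : (V →L[ℝ] ℝ) →L[ℝ] ℝ) : (V →L[ℝ] ℝ) →ₗ[ℝ] ℝ) ∈
      Submodule.span ℝ (Set.range fun x : s => L x) := by
    refine mem_span_of_iInf_ker_le_ker fun f hf => ?_
    have := hext ⟨f, hf⟩
    simp only [LinearMap.mem_ker]
    simpa [sub_eq_zero] using this.symm
  have hrange : Submodule.span ℝ (Set.range fun x : s => L x) ≤ LinearMap.range L := by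
    rw [Submodule.span_le]
    rintro _ ⟨x, rfl⟩
    exact ⟨x, rfl⟩
  obtain ⟨x, hx⟩ := hrange hspan
  have hΨ' : Ψ' = Ψ - NormedSpace.inclusionInDoubleDual ℝ V x := by
    ext f
    have := LinearMap.congr_fun hx f
    simp [L] at this ⊢
    linarith
  have hlt := hη.trans_le (hd x)
  rw [← hΨ', hnorm] at hlt
  obtain ⟨f, hf, hηf⟩ := ContinuousLinearMap.exists_lt_apply_of_lt_opNorm _ hlt
  have hf1 : ‖(f : V →L[ℝ] ℝ)‖ ≤ 1 := hf.le
  have hf0 := (hN f).1 f.2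
  simp only [ContinuousLinearMap.comp_apply, Submodule.subtypeL_apply, Real.norm_eq_abs,
    lt_abs] at hηf
  rcases hηf with h | h
  · exact ⟨f, hf1, hf0, h⟩
  · exact ⟨-f, by simpa using hf1, fun y hy => by simp [hf0 y hy], by simpa using h⟩

/-- Finitely many functionals can be made large simultaneously at a point of norm at most `‖Ψ‖`
if `Ψ` is larger at all of them. -/
theorem exists_forall_lt_apply {Ψ : (V →L[ℝ] ℝ) →L[ℝ] ℝ} (hΨ : 0 < ‖Ψ‖) {η : ℝ}
    (s : Finset (V →L[ℝ] ℝ)) (hs : ∀ f ∈ s, η < Ψ f) :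
    ∃ x : V, ‖x‖ ≤ ‖Ψ‖ ∧ ∀ f ∈ s, η < f x := by
  classical
  let T : V →L[ℝ] (s → ℝ) := ContinuousLinearMap.pi fun f => (f : V →L[ℝ] ℝ)
  let p : s → ℝ := fun f => Ψ f
  have hp : p ∈ closure (T '' closedBall 0 ‖Ψ‖) := by
    by_contra hp
    obtain ⟨g, u, hgu, hup⟩ := geometric_hahn_banach_closed_point
      (((convex_closedBall (0 : V) ‖Ψ‖).linear_image T.toLinearMap).closure)
      isClosed_closure hp
    let F : V →L[ℝ] ℝ := g.comp T
    have hF : ∀ z ∈ closedBall (0 : V) ‖Ψ‖, F z < u := fun z hz =>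
      hgu _ (subset_closure ⟨z, hz, rfl⟩)
    have hF' : ∀ z ∈ closedBall (0 : V) ‖Ψ‖, ‖F.toLinearMap z‖ ≤ u := fun z hz => by
      have h1 := hF z hz
      have h2 := hF (-z) (by simpa using hz)
      rw [map_neg] at h2
      exact abs_le.2 ⟨by simp; linarith, h1.le⟩
    have hu : 0 ≤ u := (norm_nonneg _).trans (hF' 0 (mem_closedBall_self hΨ.le))
    have hnF : ‖F‖ ≤ u / ‖Ψ‖ := F.opNorm_le_bound (div_nonneg hu hΨ.le)
      (LinearMap.bound_of_ball_bound' hΨ u F.toLinearMap hF')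
    have hsum : ∀ q : s → ℝ, g q = ∑ f, q f * g (Pi.single f 1) := by
      intro q
      conv_lhs => rw [pi_eq_sum_univ' q]
      simp [map_sum]
    have hFsum : F = ∑ f : s, g (Pi.single f 1) • (f : V →L[ℝ] ℝ) := by
      ext v
      simp only [F, ContinuousLinearMap.comp_apply, hsum (T v)]
      simp [T, mul_comm]
    have hΨF : Ψ F = g p := by
      rw [hsum p, hFsum, map_sum]
      simp [p, mul_comm]
    have h1 : Ψ F ≤ ‖Ψ‖ * ‖F‖ := (le_abs_self _).trans (Ψ.le_opNorm F)
    have h2 : ‖Ψ‖ * ‖F‖ ≤ u := by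
      rw [le_div_iff₀ hΨ] at hnF
      linarith
    linarith
  have hopen : IsOpen {q : s → ℝ | ∀ f, η < q f} := by
    simp only [Set.ofPred_forall]
    exact isOpen_iInter_of_finite fun f => isOpen_lt continuous_const (continuous_apply f)
  obtain ⟨_, hq, x, hx, rfl⟩ := mem_closure_iff.1 hp _ hopen fun f => hs f f.2
  exact ⟨x, by simpa using hx, fun f hf => hq ⟨f, hf⟩⟩

/-- Triangular James sequences in a non-reflexive Banach space. -/
theorem exists_triangular_sequences [CompleteSpace V]
    (h : ¬ Function.Surjective (NormedSpace.inclusionInDoubleDual ℝ V)) :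
    ∃ η R : ℝ, 0 < η ∧ 0 < R ∧ ∃ (f : ℕ → V →L[ℝ] ℝ) (x : ℕ → V), (∀ n, ‖f n‖ ≤ 1) ∧
      (∀ n, ‖x n‖ ≤ R) ∧ (∀ n m, n ≤ m → η ≤ f n (x m)) ∧ ∀ n m, m < n → f n (x m) = 0 := by
  obtain ⟨Ψ, hΨ⟩ : ∃ Ψ, Ψ ∉ Set.range (NormedSpace.inclusionInDoubleDual ℝ V) := by
    simpa [Function.Surjective] using h
  have hclosed : IsClosed (Set.range (NormedSpace.inclusionInDoubleDual ℝ V)) := by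
    have h := (NormedSpace.inclusionInDoubleDualLi ℝ (E := V)).isometry.isUniformInducing
    exact h.isComplete_range.isClosed
  have hd := (hclosed.notMem_iff_infDist_pos (Set.range_nonempty _)).1 hΨ
  set d := infDist Ψ (Set.range (NormedSpace.inclusionInDoubleDual ℝ V))
  have hdle : ∀ x : V, d ≤ ‖Ψ - NormedSpace.inclusionInDoubleDual ℝ V x‖ := fun x =>
    (infDist_le_dist_of_mem (Set.mem_range_self x)).trans_eq 
      (dist_eq_norm (E := (V →L[ℝ] ℝ) →L[ℝ] ℝ) Ψ _)
  have hpos : 0 < ‖Ψ‖ := hd.trans_le (by simpa using hdle 0)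
  obtain ⟨F, hF, hF'⟩ := exists_seq_of_forall_finset_exists
    (fun q : (V →L[ℝ] ℝ) × V => (‖q.1‖ ≤ 1 ∧ d / 2 < Ψ q.1) ∧ ‖q.2‖ ≤ ‖Ψ‖ ∧ d / 2 < q.1 q.2)
    (fun q q' => q'.1 q.2 = 0 ∧ d / 2 < q.1 q'.2) (by
      classical
      intro s hs
      obtain ⟨f, hf1, hf0, hfΨ⟩ :=
        exists_annihilator_lt_apply Ψ hdle (half_lt_self hd) (s.image Prod.snd)
      obtain ⟨x, hx, hx'⟩ := exists_forall_lt_apply hpos (insert f (s.image Prod.fst))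
        (η := d / 2) (by
          intro g hg
          rcases Finset.mem_insert.1 hg with rfl | hg
          · exact hfΨ
          · obtain ⟨q, hq, rfl⟩ := Finset.mem_image.1 hg
            exact (hs q hq).1.2)
      exact ⟨(f, x), ⟨⟨hf1, hfΨ⟩, hx, hx' _ (Finset.mem_insert_self _ _)⟩, fun q hq =>
        ⟨hf0 _ (Finset.mem_image_of_mem _ hq),
          hx' _ (Finset.mem_insert_of_mem (Finset.mem_image_of_mem _ hq))⟩⟩)
  refine ⟨d / 2, ‖Ψ‖, half_pos hd, hpos, fun n => (F n).1, fun n => (F n).2,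
    fun n => (hF n).1.1, fun n => (hF n).2.1, fun n m hnm => ?_, fun n m hmn => (hF' m n hmn).1⟩
  rcases hnm.eq_or_lt with rfl | hlt
  · exact (hF n).2.2.le
  · exact (hF' n m hlt).2.le

/-- A decreasing sequence of nonempty convex subsets of the dual unit ball. -/
structure IsConvexChain (C : ℕ → Set (V →L[ℝ] ℝ)) : Prop where
  antitone : Antitone C
  convex : ∀ j, Convex ℝ (C j)
  nonempty : ∀ j, (C j).Nonempty
  norm_le_one : ∀ j, ∀ c ∈ C j, ‖c‖ ≤ 1

/-- The intersection of the weak-star closures of a sequence of sets of functionals. -/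
def weakStarLimit (C : ℕ → Set (V →L[ℝ] ℝ)) : Set (V →L[ℝ] ℝ) :=
  {w | ∀ j, StrongDual.toWeakDual w ∈ closure (StrongDual.toWeakDual '' C j)}

theorem weakStarLimit_mono {C C' : ℕ → Set (V →L[ℝ] ℝ)} (h : C' ≤ C) :
    weakStarLimit C' ⊆ weakStarLimit C :=
  fun _ hw j => closure_mono (Set.image_mono (h j)) (hw j)

theorem mem_of_mem_weakStarLimit {C : ℕ → Set (V →L[ℝ] ℝ)} {w : V →L[ℝ] ℝ}
    (hw : w ∈ weakStarLimit C) {j : ℕ} {x : V} {S : Set ℝ} (hS : IsClosed S)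
    (h : ∀ c ∈ C j, c x ∈ S) : w x ∈ S := by
  have hcl : IsClosed {v : WeakDual ℝ V | v x ∈ S} := hS.preimage (WeakDual.eval_continuous x)
  refine closure_minimal ?_ hcl (hw j)
  rintro _ ⟨c, hc, rfl⟩
  exact h c hc

theorem IsConvexChain.norm_le_one_of_mem_weakStarLimit {C : ℕ → Set (V →L[ℝ] ℝ)}
    (hC : IsConvexChain C) {w : V →L[ℝ] ℝ} (hw : w ∈ weakStarLimit C) : ‖w‖ ≤ 1 := by
  refine w.opNorm_le_bound zero_le_one fun x => ?_
  have := mem_of_mem_weakStarLimit hw (j := 0) (x := x) (S := closedBall 0 (1 * ‖x‖))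
    isClosed_closedBall fun c hc => by
      simpa using c.le_of_opNorm_le (hC.norm_le_one 0 c hc) x
  simpa using this

/-- A weak-star cluster point of a bounded sequence of functionals. -/
theorem exists_mapClusterPt_toWeakDual (y : ℕ → V →L[ℝ] ℝ) (hy : ∀ n, ‖y n‖ ≤ 1) :
    ∃ w : V →L[ℝ] ℝ,
      MapClusterPt (StrongDual.toWeakDual w) atTop fun n => StrongDual.toWeakDual (y n) := by
  obtain ⟨w, -, hw⟩ := (WeakDual.isCompact_closedBall (𝕜 := ℝ) (0 : StrongDual ℝ V) 1
    ).exists_mapClusterPt (f := atTop) (u := fun n => StrongDual.toWeakDual (y n)) (by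
      rw [le_principal_iff, mem_map]
      exact Eventually.of_forall fun n => by simpa using hy n)
  exact ⟨WeakDual.toStrongDual w, hw⟩

theorem mem_weakStarLimit_of_mapClusterPt {C : ℕ → Set (V →L[ℝ] ℝ)} {y : ℕ → V →L[ℝ] ℝ}
    {w : V →L[ℝ] ℝ} (hy : ∀ j, ∀ᶠ n in atTop, y n ∈ C j)
    (hw : MapClusterPt (StrongDual.toWeakDual w) atTop fun n => StrongDual.toWeakDual (y n)) :
    w ∈ weakStarLimit C := fun j =>
  ClusterPt.mem_closure_of_mem hw _ ((hy j).mono fun n hn => ⟨y n, hn, rfl⟩)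

theorem IsConvexChain.weakStarLimit_nonempty {C : ℕ → Set (V →L[ℝ] ℝ)} (hC : IsConvexChain C) :
    (weakStarLimit C).Nonempty := by
  choose y hy using hC.nonempty
  obtain ⟨w, hw⟩ := exists_mapClusterPt_toWeakDual y fun n => hC.norm_le_one n _ (hy n)
  exact ⟨w, mem_weakStarLimit_of_mapClusterPt (fun j => (eventually_ge_atTop j).mono fun n hn =>
    hC.antitone hn (hy n)) hw⟩

/-- Pryce-type stabilization: after passing to a smaller chain, the distance from `h` to every
weak-star limit is almost the given distance to one of them. -/
theorem IsConvexChain.exists_le_forall_le_norm {C : ℕ → Set (V →L[ℝ] ℝ)} (hC : IsConvexChain C)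
    {h w : V →L[ℝ] ℝ} (hw : w ∈ weakStarLimit C) {a : ℝ} (ha : a < ‖h - w‖) :
    ∃ C' ≤ C, IsConvexChain C' ∧ ∀ w' ∈ weakStarLimit C', a ≤ ‖h - w'‖ := by
  obtain ⟨x, hx, hax⟩ : ∃ x : V, ‖x‖ ≤ 1 ∧ a < (h - w) x := by
    obtain ⟨x, hx, hax⟩ := ContinuousLinearMap.exists_lt_apply_of_lt_opNorm _ ha
    rw [Real.norm_eq_abs, lt_abs] at hax
    rcases hax with hax | hax
    · exact ⟨x, hx.le, hax⟩
    · exact ⟨-x, by simpa using hx.le, by rwa [map_neg]⟩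
  have hax' : w x < h x - a := by
    rw [sub_apply] at hax
    linarith
  refine ⟨fun j => C j ∩ {c | c x < h x - a}, fun j => Set.inter_subset_left,
    ⟨fun i j hij => Set.inter_subset_inter_left _ (hC.antitone hij), fun j => ?_, fun j => ?_,
      fun j c hc => hC.norm_le_one j c hc.1⟩, fun w' hw' => ?_⟩
  · exact (hC.convex j).inter
      (convex_halfSpace_lt (ContinuousLinearMap.apply ℝ ℝ x).toLinearMap.isLinear _)
  · have hopen : IsOpen {v : WeakDual ℝ V | v x < h x - a} :=
      isOpen_lt (WeakDual.eval_continuous x) continuous_const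
    obtain ⟨_, hc', c, hc, rfl⟩ := mem_closure_iff.1 (hw j) _ hopen hax'
    exact ⟨c, hc, hc'⟩
  · have h1 : w' x ≤ h x - a := mem_of_mem_weakStarLimit hw' (j := 0) (S := Set.Iic (h x - a))
      isClosed_Iic fun c hc => Set.mem_Iic.2 (le_of_lt (show c x < h x - a from hc.2))
    have h2 := (le_abs_self _).trans ((h - w').le_of_opNorm_le_of_le le_rfl hx)
    rw [sub_apply] at h2
    linarith

/-- An almost optimal choice of a point `u` of `T` and a smaller chain, for the largest
distance to weak-star limits. -/
theorem IsConvexChain.exists_almost_minimal {C : ℕ → Set (V →L[ℝ] ℝ)} (hC : IsConvexChain C)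
    {T : Set (V →L[ℝ] ℝ)} (hT : T.Nonempty) {ε : ℝ} (hε : 0 < ε) :
    ∃ u ∈ T, ∃ C' ≤ C, IsConvexChain C' ∧ ∃ g : ℝ,
      (∀ w ∈ weakStarLimit C', g - ε ≤ ‖u - w‖ ∧ ‖u - w‖ ≤ g) ∧
      ∀ u' ∈ T, ∀ C'' ≤ C, IsConvexChain C'' → ∃ w ∈ weakStarLimit C'', g - ε ≤ ‖u' - w‖ := by
  let G : (V →L[ℝ] ℝ) → (ℕ → Set (V →L[ℝ] ℝ)) → ℝ := fun u D =>
    sSup ((fun w => ‖u - w‖) '' weakStarLimit D)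
  have hle : ∀ u D, IsConvexChain D → ∀ w ∈ weakStarLimit D, ‖u - w‖ ≤ G u D := by
    intro u D hD w hw
    refine le_csSup ⟨‖u‖ + 1, ?_⟩ ⟨w, hw, rfl⟩
    rintro _ ⟨w', hw', rfl⟩
    exact (norm_sub_le _ _).trans (by gcongr; exact hD.norm_le_one_of_mem_weakStarLimit hw')
  have hlt : ∀ u D, IsConvexChain D → ∀ a < G u D, ∃ w ∈ weakStarLimit D, a < ‖u - w‖ := by
    intro u D hD a ha
    obtain ⟨_, ⟨w, hw, rfl⟩, h⟩ := exists_lt_of_lt_csSup (hD.weakStarLimit_nonempty.image _) ha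
    exact ⟨w, hw, h⟩
  have hG0 : ∀ u D, IsConvexChain D → 0 ≤ G u D := fun u D hD => by
    obtain ⟨w, hw⟩ := hD.weakStarLimit_nonempty
    exact (norm_nonneg _).trans (hle u D hD w hw)
  let S : Set ℝ := {t | ∃ u ∈ T, ∃ D ≤ C, IsConvexChain D ∧ G u D = t}
  have hSbdd : BddBelow S := ⟨0, by rintro _ ⟨u, -, D, -, hD, rfl⟩; exact hG0 u D hD⟩
  obtain ⟨u₀, hu₀⟩ := hT
  have hSne : S.Nonempty := ⟨_, u₀, hu₀, C, le_rfl, hC, rfl⟩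
  obtain ⟨_, ⟨u, hu, D, hDC, hD, rfl⟩, hlow⟩ :=
    exists_lt_of_csInf_lt hSne (lt_add_of_pos_right (sInf S) (half_pos hε))
  have hmin : ∀ u' ∈ T, ∀ C'' ≤ C, IsConvexChain C'' →
      ∃ w ∈ weakStarLimit C'', G u D - ε ≤ ‖u' - w‖ := by
    intro u' hu' C'' hC'' hgood
    have h1 : sInf S ≤ G u' C'' := csInf_le hSbdd ⟨u', hu', C'', hC'', hgood, rfl⟩
    obtain ⟨w, hw, h⟩ := hlt u' C'' hgood (G u D - ε) (by linarith)
    exact ⟨w, hw, h.le⟩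
  obtain ⟨C', hC'D, hC', hlower⟩ : ∃ C' ≤ D, IsConvexChain C' ∧
      ∀ w ∈ weakStarLimit C', G u D - ε ≤ ‖u - w‖ := by
    obtain ⟨w, hw, h⟩ := hlt u D hD (G u D - ε) (by linarith)
    exact hD.exists_le_forall_le_norm hw h
  exact ⟨u, hu, C', hC'D.trans hDC, hC', G u D, fun w hw =>
    ⟨hlower w hw, hle u D hD w (weakStarLimit_mono hC'D hw)⟩, hmin⟩

/-- Simultaneous construction of a rapidly optimizing sequence for which the distances to all of
its weak-star cluster points are controlled. -/
theorem IsConvexChain.exists_optimizing_sequence {C : ℕ → Set (V →L[ℝ] ℝ)}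
    (hC : IsConvexChain C) {ε : ℕ → ℝ} (hε : ∀ n, 0 < ε n) :
    ∃ h y : ℕ → V →L[ℝ] ℝ, h 0 = 0 ∧ (∀ n, h (n + 1) = h n + (1 / 2 : ℝ) ^ (n + 1) • y n) ∧
      (∀ n, ‖y n‖ ≤ 1) ∧ (∀ n, h n + (1 / 2 : ℝ) ^ n • y n ∈ C 0) ∧
      ∀ w : V →L[ℝ] ℝ,
        MapClusterPt (StrongDual.toWeakDual w) atTop (fun n => StrongDual.toWeakDual (y n)) →
        w ∈ weakStarLimit C ∧ ∀ n m, n ≤ m →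
          ‖h n + (1 / 2 : ℝ) ^ n • y n - w‖ ≤
            ‖h m + (1 / 2 : ℝ) ^ m • y m - w‖ + ε n + ε m := by
  have step : ∀ (n : ℕ) (s : {D : ℕ → Set (V →L[ℝ] ℝ) // IsConvexChain D} × (V →L[ℝ] ℝ)),
      ∃ (y : V →L[ℝ] ℝ) (D : {D : ℕ → Set (V →L[ℝ] ℝ) // IsConvexChain D}) (g : ℝ),
        y ∈ s.1.1 n ∧ D.1 ≤ s.1.1 ∧
        (∀ w ∈ weakStarLimit D.1, g - ε n ≤ ‖s.2 + (1 / 2 : ℝ) ^ n • y - w‖ ∧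
          ‖s.2 + (1 / 2 : ℝ) ^ n • y - w‖ ≤ g) ∧
        ∀ y' ∈ s.1.1 n, ∀ D' ≤ s.1.1, IsConvexChain D' →
          ∃ w ∈ weakStarLimit D', g - ε n ≤ ‖s.2 + (1 / 2 : ℝ) ^ n • y' - w‖ := by
    rintro n ⟨⟨D, hD⟩, k⟩
    obtain ⟨_, ⟨y, hy, rfl⟩, D', hD'D, hD', g, h1, h2⟩ := hD.exists_almost_minimal
      ((hD.nonempty n).image fun y => k + (1 / 2 : ℝ) ^ n • y) (hε n)
    exact ⟨y, ⟨D', hD'⟩, g, hy, hD'D, h1, fun y' hy' => h2 _ ⟨y', hy', rfl⟩⟩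
  choose Y N g hY hN hg hmin using step
  let s : ℕ → {D : ℕ → Set (V →L[ℝ] ℝ) // IsConvexChain D} × (V →L[ℝ] ℝ) := fun n =>
    Nat.rec (⟨C, hC⟩, 0) (fun n s => (N n s, s.2 + (1 / 2 : ℝ) ^ (n + 1) • Y n s)) n
  have hs : Antitone fun n => (s n).1.1 := antitone_nat_of_succ_le fun n => hN n (s n)
  let T : ℕ → Set (V →L[ℝ] ℝ) := fun n =>
    (fun y => (s n).2 + (1 / 2 : ℝ) ^ n • y) '' (s n).1.1 n
  have hT : Antitone T := by
    refine antitone_nat_of_succ_le fun n => ?_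
    rintro _ ⟨y, hy, rfl⟩
    have hy' : y ∈ (s n).1.1 n := (s n).1.2.antitone n.le_succ (hs n.le_succ _ hy)
    refine ⟨(1 / 2 : ℝ) • Y n (s n) + (1 / 2 : ℝ) • y,
      (s n).1.2.convex n (hY n (s n)) hy' (by norm_num) (by norm_num) (by norm_num), ?_⟩
    change (s n).2 + _ = ((s n).2 + (1 / 2 : ℝ) ^ (n + 1) • Y n (s n)) + _
    rw [pow_succ]
    module
  have hu : ∀ n, (s n).2 + (1 / 2 : ℝ) ^ n • Y n (s n) ∈ T n := fun n => ⟨_, hY n (s n), rfl⟩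
  refine ⟨fun n => (s n).2, fun n => Y n (s n), rfl, fun n => rfl,
    fun n => (s n).1.2.norm_le_one n _ (hY n (s n)), fun n => ?_, fun w hw => ?_⟩
  · obtain ⟨y, hy, h⟩ := hT n.zero_le (hu n)
    have : y = (s n).2 + (1 / 2 : ℝ) ^ n • Y n (s n) := by
      simpa [s] using h
    exact this ▸ hy
  · have hws : ∀ n, w ∈ weakStarLimit (s n).1.1 := fun n =>
      mem_weakStarLimit_of_mapClusterPt (fun j => by
        filter_upwards [eventually_ge_atTop n, eventually_ge_atTop j] with k hnk hjk
        exact (s n).1.2.antitone hjk (hs hnk _ (hY k (s k)))) hw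
    refine ⟨hws 0, fun n m hnm => ?_⟩
    obtain ⟨y', hy', hy'eq⟩ := hT hnm (hu m)
    obtain ⟨w', hw', h1⟩ := hmin n (s n) y' hy' _ (hs (hnm.trans m.le_succ)) (s (m + 1)).1.2
    have h2 := (hg n (s n) w (hws (n + 1))).2
    have h3 := (hg m (s m) w (hws (m + 1))).1
    have h4 := (hg m (s m) w' hw').2
    simp only at hy'eq
    rw [hy'eq] at h1
    linarith

theorem exists_tendsto_of_le_succ_add_geometric {a : ℕ → ℝ} {c b : ℝ} (hc : 0 ≤ c)
    (hb : ∀ n, a n ≤ b) (ha : ∀ n, a n ≤ a (n + 1) + c * (1 / 2) ^ n) :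
    ∃ l, Tendsto a atTop (𝓝 l) ∧ a 0 - 2 * c ≤ l := by
  let d : ℕ → ℝ := fun n => a n - 2 * c * (1 / 2) ^ n
  have hd : Monotone d := monotone_nat_of_le_succ fun n => by
    have := ha n
    simp only [d, pow_succ]
    linarith
  have hbdd : BddAbove (Set.range d) := ⟨b, by
    rintro _ ⟨n, rfl⟩
    have : 0 ≤ 2 * c * (1 / 2 : ℝ) ^ n := by positivity
    have := hb n
    simp only [d]
    linarith⟩
  have h0 : Tendsto (fun n : ℕ => 2 * c * (1 / 2 : ℝ) ^ n) atTop (𝓝 0) := by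
    simpa using (tendsto_pow_atTop_nhds_zero_of_lt_one (r := (1 / 2 : ℝ)) (by norm_num)
      (by norm_num)).const_mul (2 * c)
  have hlim := (tendsto_atTop_ciSup hd hbdd).add h0
  refine ⟨⨆ n, d n, by simpa [d] using hlim, ?_⟩
  simpa [d] using le_ciSup hbdd 0

/-- If all elements of a convex chain stay away from its weak-star limits, some functional does
not attain its norm on the unit ball. -/
theorem IsConvexChain.exists_forall_apply_ne_norm {C : ℕ → Set (V →L[ℝ] ℝ)}
    (hC : IsConvexChain C) {θ : ℝ} (hθ : 0 < θ)
    (h : ∀ u ∈ C 0, ∀ w ∈ weakStarLimit C, θ ≤ ‖u - w‖) :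
    ∃ F : V →L[ℝ] ℝ, ∀ x, ‖x‖ ≤ 1 → F x ≠ ‖F‖ := by
  let c := θ / 4
  have hc : 0 < c := by positivity
  obtain ⟨k, y, hk0, hk, hy, hu, hcluster⟩ :=
    hC.exists_optimizing_sequence (ε := fun n => c * (1 / 4) ^ n) fun n => by positivity
  obtain ⟨w, hw⟩ := exists_mapClusterPt_toWeakDual y hy
  obtain ⟨hwC, hmono⟩ := hcluster w hw
  have hdist : ∀ n, dist (k n) (k (n + 1)) ≤ 1 / 2 / 2 ^ n := fun n => by
    rw [hk, dist_self_add_right, norm_smul, Real.norm_of_nonneg (by positivity)]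
    calc (1 / 2 : ℝ) ^ (n + 1) * ‖y n‖ ≤ (1 / 2) ^ (n + 1) * 1 := by gcongr; exact hy n
      _ = 1 / 2 / 2 ^ n := by rw [pow_succ, one_div_pow]; ring
  obtain ⟨z, hz⟩ := cauchySeq_tendsto_of_complete (cauchySeq_of_le_geometric_two hdist)
  have hkz : ∀ n, ‖k n - z‖ ≤ 1 / 2 ^ n := fun n => by
    rw [← dist_eq_norm]
    exact dist_le_of_le_geometric_two_of_tendsto hdist hz n
  have hpow : ∀ r : ℝ, 0 ≤ r → r < 1 → Tendsto (fun n : ℕ => r ^ n) atTop (𝓝 0) := fun r h0 h1 =>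
    tendsto_pow_atTop_nhds_zero_of_lt_one h0 h1
  have hsmall : Tendsto (fun n => (1 / 2 : ℝ) ^ n • y n) atTop (𝓝 0) := by
    refine squeeze_zero_norm (fun n => ?_) (hpow (1 / 2) (by norm_num) (by norm_num))
    rw [norm_smul, Real.norm_of_nonneg (by positivity)]
    exact mul_le_of_le_one_right (by positivity) (hy n)
  have huz : Tendsto (fun n => ‖k n + (1 / 2 : ℝ) ^ n • y n - w‖) atTop (𝓝 ‖z - w‖) := by
    simpa using ((hz.add hsmall).sub_const w).norm
  have hθz : θ ≤ ‖z - w‖ := ge_of_tendsto' huz fun n => h _ (hu n) w hwC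
  have huw : ∀ n, ‖k n + (1 / 2 : ℝ) ^ n • y n - w‖ ≤ ‖z - w‖ + c * (1 / 4) ^ n := by
    intro n
    have hlim := (huz.add_const (c * (1 / 4) ^ n)).add
      ((hpow (1 / 4) (by norm_num) (by norm_num)).const_mul c)
    rw [mul_zero, add_zero] at hlim
    exact ge_of_tendsto hlim ((eventually_ge_atTop n).mono fun m hm => hmono n m hm)
  refine ⟨z - w, fun x hx hattain => ?_⟩
  let a : ℕ → ℝ := fun n => 2 ^ n * (z x - k n x)
  have hle : ∀ n, y n x ≤ a n + c * (1 / 2) ^ n := by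
    intro n
    have h1 := (le_abs_self _).trans
      ((k n + (1 / 2 : ℝ) ^ n • y n - w).le_of_opNorm_le_of_le (huw n) hx)
    rw [← hattain] at h1
    simp only [sub_apply, add_apply, smul_apply, smul_eq_mul, mul_one] at h1
    have h2 : (1 / 2 : ℝ) ^ n * y n x ≤ z x - k n x + c * (1 / 4) ^ n := by linarith
    have h3 := mul_le_mul_of_nonneg_left h2 (pow_nonneg (zero_le_two (α := ℝ)) n)
    rw [← mul_assoc, ← mul_pow, mul_add, mul_left_comm, ← mul_pow] at h3
    norm_num at h3 ⊢
    exact h3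
  have hsucc : ∀ n, a (n + 1) = 2 * a n - y n x := by
    intro n
    have h1 : (2 : ℝ) ^ (n + 1) * (1 / 2) ^ (n + 1) = 1 := by rw [← mul_pow]; norm_num
    simp only [a, hk, add_apply, smul_apply, smul_eq_mul]
    linear_combination (-(y n x)) * h1
  have hbound : ∀ n, a n ≤ 1 := by
    intro n
    have h1 := (le_abs_self _).trans ((z - k n).le_of_opNorm_le_of_le
      ((norm_sub_rev _ _).trans_le (hkz n)) hx)
    rw [sub_apply, mul_one, le_div_iff₀ (by positivity)] at h1
    simp only [a]
    linarith
  obtain ⟨l, hl, hal⟩ := exists_tendsto_of_le_succ_add_geometric hc.le hbound fun n => by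
    linarith [hle n, hsucc n]
  have hyl : Tendsto (fun n => y n x) atTop (𝓝 l) := by
    have := (hl.const_mul 2).sub (hl.comp (tendsto_add_atTop_nat 1))
    refine (this.congr fun n => ?_).trans_eq ?_
    · simp [hsucc]
    · ring_nf
  have hwl : w x = l := by
    have h1 : MapClusterPt (w x) atTop fun n => y n x :=
      hw.continuousAt_comp (WeakDual.eval_continuous x).continuousAt
    exact eq_of_nhds_neBot (NeBot.mono h1 (inf_le_inf_left _ hyl))
  have ha0 : a 0 = z x := by simp [a, hk0]
  rw [sub_apply] at hattain
  simp only [c] at hal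
  linarith

/-- James theorem: a Banach space on which every functional attains its norm is reflexive. -/
theorem surjective_inclusionInDoubleDual_of_forall_attains [CompleteSpace V]
    (h : ∀ f : V →L[ℝ] ℝ, ∃ x, ‖x‖ ≤ 1 ∧ f x = ‖f‖) :
    Function.Surjective (NormedSpace.inclusionInDoubleDual ℝ V) := by
  by_contra hV
  obtain ⟨η, R, hη, hR, f, x, hf, hx, hfx, hfx0⟩ := exists_triangular_sequences hV
  let C : ℕ → Set (V →L[ℝ] ℝ) := fun j => convexHull ℝ (f '' Set.Ici j)
  have hC : IsConvexChain C := by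
    refine ⟨fun i j hij => convexHull_mono (Set.image_mono (Set.Ici_subset_Ici.2 hij)),
      fun j => convex_convexHull _ _, fun j => ⟨f j, subset_convexHull _ _ ⟨j, Set.self_mem_Ici, rfl⟩⟩,
      fun j c hc => ?_⟩
    have : convexHull ℝ (f '' Set.Ici j) ⊆ closedBall 0 1 :=
      convexHull_min (by rintro _ ⟨n, -, rfl⟩; simpa using hf n) (convex_closedBall _ _)
    simpa using this hc
  have hlin : ∀ v : V, IsLinearMap ℝ fun g : V →L[ℝ] ℝ => g v := fun v =>
    (ContinuousLinearMap.apply ℝ ℝ v).toLinearMap.isLinear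
  have hlim : ∀ w ∈ weakStarLimit C, ∀ m, w (x m) = 0 := by
    intro w hw m
    refine mem_of_mem_weakStarLimit hw (j := m + 1) (S := {0}) isClosed_singleton fun c hc => ?_
    have : C (m + 1) ⊆ {g | g (x m) = 0} :=
      convexHull_min (by rintro _ ⟨n, hn, rfl⟩; exact hfx0 n m hn) (convex_hyperplane (hlin _) _)
    exact this hc
  have hlarge : ∀ u ∈ C 0, ∃ m, η ≤ u (x m) := by
    have hsub : C 0 ⊆ {u | ∃ m, ∀ j ≥ m, η ≤ u (x j)} := by
      refine convexHull_min ?_ ?_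
      · rintro _ ⟨n, -, rfl⟩
        exact ⟨n, fun j hj => hfx n j hj⟩
      · rintro u ⟨m, hm⟩ v ⟨m', hm'⟩ a b ha hb hab
        refine ⟨max m m', fun j hj => ?_⟩
        exact convex_halfSpace_ge (hlin (x j)) η (hm j (le_of_max_le_left hj))
          (hm' j (le_of_max_le_right hj)) ha hb hab
    intro u hu
    obtain ⟨m, hm⟩ := hsub hu
    exact ⟨m, hm m le_rfl⟩
  obtain ⟨F, hF⟩ := hC.exists_forall_apply_ne_norm (div_pos hη hR) fun u hu w hw => by
    obtain ⟨m, hm⟩ := hlarge u hu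
    have h1 := (le_abs_self _).trans ((u - w).le_of_opNorm_le_of_le le_rfl (hx m))
    rw [sub_apply, hlim w hw m, sub_zero] at h1
    rw [div_le_iff₀ hR]
    exact hm.trans h1
  obtain ⟨v, hv, hFv⟩ := h F
  exact hF v hv hFv

/-- On a reflexive space every nonzero functional attains its norm at a unit vector. -/
theorem exists_norm_eq_one_apply_eq_norm
    (h : Function.Surjective (NormedSpace.inclusionInDoubleDual ℝ V))
    {f : V →L[ℝ] ℝ} (hf : f ≠ 0) : ∃ x : V, ‖x‖ = 1 ∧ f x = ‖f‖ := by
  obtain ⟨Ψ, hΨ, hΨf⟩ := exists_dual_vector ℝ f (norm_ne_zero_iff.2 hf)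
  obtain ⟨x, rfl⟩ := h Ψ
  exact ⟨x, ((NormedSpace.inclusionInDoubleDualLi ℝ (E := V)).norm_map x).symm.trans hΨ,
    by simpa using hΨf⟩

end JamesReflexivity

theorem IsWeightFun.exists_eq {φ : ℝ → ℝ} (hφ : IsWeightFun φ) {s : ℝ} (hs : 0 ≤ s) :
    ∃ t, 0 ≤ t ∧ φ t = s := by
  obtain ⟨hcont, -, h0, -, htop⟩ := hφ
  obtain ⟨b, hb, hb0⟩ := ((htop.eventually_ge_atTop s).and (Filter.eventually_ge_atTop 0)).exists
  obtain ⟨t, ht, rfl⟩ := intermediate_value_Icc hb0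
    (hcont.mono Set.Icc_subset_Ici_self) ⟨h0.trans_le hs, hb⟩
  exact ⟨t, ht.1, rfl⟩

/-- A real Banach space `V` is reflexive (the canonical embedding into the bidual is
surjective) if and only if the duality mapping `J_V^φ` is surjective, for any weight
function `φ`. -/
theorem statement7 {V : Type*} [NormedAddCommGroup V] [NormedSpace ℝ V] [CompleteSpace V]
    (φ : ℝ → ℝ) (hφ : IsWeightFun φ) :
    Function.Surjective ⇑(NormedSpace.inclusionInDoubleDual ℝ V) ↔
      ∀ f : V →L[ℝ] ℝ, ∃ v : V, f ∈ dualitySet V φ v := by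
  constructor
  · intro h f
    rcases eq_or_ne f 0 with rfl | hf
    · exact ⟨0, by simp [dualitySet, hφ.2.2.1]⟩
    · obtain ⟨x, hx, hfx⟩ := JamesReflexivity.exists_norm_eq_one_apply_eq_norm h hf
      obtain ⟨t, ht, hφt⟩ := hφ.exists_eq (norm_nonneg f)
      have hnorm : ‖t • x‖ = t := by rw [norm_smul, hx, mul_one, Real.norm_of_nonneg ht]
      exact ⟨t • x, by rw [map_smul, hnorm, hfx, smul_eq_mul], by rw [hnorm, hφt]⟩
  · intro h
    refine JamesReflexivity.surjective_inclusionInDoubleDual_of_forall_attains fun f => ?_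
    obtain ⟨v, hv, hfv⟩ := h f
    rcases eq_or_ne v 0 with rfl | hv0
    · refine ⟨0, by simp, ?_⟩
      rw [hfv, norm_zero, hφ.2.2.1, map_zero]
    · have hv' := norm_ne_zero_iff.2 hv0
      refine ⟨‖v‖⁻¹ • v, by rw [norm_smul, norm_inv, norm_norm, inv_mul_cancel₀ hv'], ?_⟩
      rw [map_smul, hv, smul_eq_mul, inv_mul_cancel_left₀ hv']
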